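/- Let f : ℝ^d → ℝ be differentiable, let r₁, r₂ : ℝ^d → ℝ be convex, and suppose every subgradient of r₁ has norm at most G₁. Assume there exist μ > 0 and R ≥ 0 such that for all x, y with ‖x − y‖ ≥ R and all subgradients u₁ of r₁ at x, u₂ of r₂ at x, v₁ of r₁ at y, v₂ of r₂ at y: ⟨∇f(x) + u₁ − u₂ − ∇f(y) − v₁ + v₂, x − y⟩ ≥ μ‖x − y‖². Then ∇f is (μ/2, max{R, 4G₁/μ})-distant dissipative, i.e., ⟨∇f(x) − ∇f(y), x − y⟩ ≥ (μ/2)‖x − y‖² whenever ‖x − y‖ ≥ max{R, 4G₁/μ}. -/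

import Mathlib

open scoped RealInnerProductSpace

/-- `u` is a subgradient of `g` at `x`. -/
def IsSubgradAt {d : ℕ} (g : EuclideanSpace ℝ (Fin d) → ℝ)
    (x u : EuclideanSpace ℝ (Fin d)) : Prop :=
  ∀ y, g x + ⟪u, y - x⟫ ≤ g y

/-- A convex function on a finite-dimensional Euclidean space has a subgradient at every point. -/
theorem ConvexOn.exists_isSubgradAt {d : ℕ} {g : EuclideanSpace ℝ (Fin d) → ℝ}
    (hg : ConvexOn ℝ Set.univ g) (x : EuclideanSpace ℝ (Fin d)) : ∃ u, IsSubgradAt g x u := by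
  have hcont : Continuous g := continuousOn_univ.1 (hg.continuousOn isOpen_univ)
  have hopen : IsOpen {p : EuclideanSpace ℝ (Fin d) × ℝ | p.1 ∈ Set.univ ∧ g p.1 < p.2} := by
    simpa using isOpen_lt (hcont.comp continuous_fst) continuous_snd
  obtain ⟨L, hL⟩ := geometric_hahn_banach_point_open (x := (x, g x))
    hg.convex_strict_epigraph hopen (by simp)
  set l := L.comp (ContinuousLinearMap.inl ℝ (EuclideanSpace ℝ (Fin d)) ℝ) with hl
  set c := L (0, 1) with hc
  have hsplit (y : EuclideanSpace ℝ (Fin d)) (t : ℝ) : L (y, t) = l y + t * c := by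
    have h : ((y, t) : EuclideanSpace ℝ (Fin d) × ℝ) = (y, 0) + t • (0, 1) := by simp
    rw [h, map_add, map_smul]
    simp [hl, hc]
  have hsep (y : EuclideanSpace ℝ (Fin d)) (t : ℝ) (ht : g y < t) :
      l x + g x * c < l y + t * c := by
    rw [← hsplit, ← hsplit]
    exact hL (y, t) ⟨Set.mem_univ _, ht⟩
  have hcpos : 0 < c := by
    have := hsep x (g x + 1) (by linarith)
    linarith
  refine ⟨-(c⁻¹ • (InnerProductSpace.toDual ℝ _).symm l), fun y => ?_⟩
  rw [inner_neg_left, real_inner_smul_left, InnerProductSpace.toDual_symm_apply, map_sub]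
  refine le_of_forall_gt_imp_ge_of_dense fun t ht => ?_
  have h : l x - l y ≤ (t - g x) * c := by linarith [hsep y t ht]
  have h' : (l x - l y) / c ≤ t - g x := (div_le_iff₀ hcpos).2 h
  have e : c⁻¹ * (l y - l x) = -((l x - l y) / c) := by ring
  linarith

/-- Subgradients are monotone. -/
theorem IsSubgradAt.inner_sub_nonneg {d : ℕ} {g : EuclideanSpace ℝ (Fin d) → ℝ}
    {x y u v : EuclideanSpace ℝ (Fin d)} (hu : IsSubgradAt g x u) (hv : IsSubgradAt g y v) :
    0 ≤ ⟪u - v, x - y⟫ := by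
  have h1 := hu y
  have h2 := hv x
  rw [← neg_sub x y, inner_neg_right] at h1
  rw [inner_sub_left]
  linarith

/-- If the generalized gradient of `V = f + r₁ − r₂` is `(μ, R)`-distant
dissipative and every subgradient of `r₁` has norm at most `G₁`, then `∇f` is
`(μ/2, max{R, 4G₁/μ})`-distant dissipative. -/
theorem gradf_distant_dissipative {d : ℕ}
    (f r1 r2 : EuclideanSpace ℝ (Fin d) → ℝ)
    (f' : EuclideanSpace ℝ (Fin d) → EuclideanSpace ℝ (Fin d))
    (G1 mu R : ℝ)
    (hf : ∀ x, HasGradientAt f (f' x) x)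
    (hr1 : ConvexOn ℝ Set.univ r1) (hr2 : ConvexOn ℝ Set.univ r2)
    (hG1 : ∀ x u, IsSubgradAt r1 x u → ‖u‖ ≤ G1)
    (hmu : 0 < mu) (hR : 0 ≤ R)
    (hdiss : ∀ x y u1 u2 v1 v2, R ≤ ‖x - y‖ →
      IsSubgradAt r1 x u1 → IsSubgradAt r2 x u2 →
      IsSubgradAt r1 y v1 → IsSubgradAt r2 y v2 →
      mu * ‖x - y‖ ^ 2 ≤ ⟪f' x + u1 - u2 - f' y - v1 + v2, x - y⟫)
    (x y : EuclideanSpace ℝ (Fin d))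
    (hxy : max R (4 * G1 / mu) ≤ ‖x - y‖) :
    (mu / 2) * ‖x - y‖ ^ 2 ≤ ⟪f' x - f' y, x - y⟫ := by
  obtain ⟨u1, hu1⟩ := hr1.exists_isSubgradAt x
  obtain ⟨u2, hu2⟩ := hr2.exists_isSubgradAt x
  obtain ⟨v1, hv1⟩ := hr1.exists_isSubgradAt y
  obtain ⟨v2, hv2⟩ := hr2.exists_isSubgradAt y
  have hV := hdiss x y u1 u2 v1 v2 ((le_max_left _ _).trans hxy) hu1 hu2 hv1 hv2
  have hmono := hu2.inner_sub_nonneg hv2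
  have hfar : 4 * G1 ≤ ‖x - y‖ * mu := (div_le_iff₀ hmu).1 ((le_max_right _ _).trans hxy)
  have hbound : ⟪u1 - v1, x - y⟫ ≤ 2 * G1 * ‖x - y‖ := by
    refine (real_inner_le_norm _ _).trans (mul_le_mul_of_nonneg_right ?_ (norm_nonneg _))
    linarith [norm_sub_le u1 v1, hG1 x u1 hu1, hG1 y v1 hv1]
  have hsplit : f' x + u1 - u2 - f' y - v1 + v2 = (f' x - f' y) + (u1 - v1) - (u2 - v2) := by
    abel
  rw [hsplit, inner_sub_left, inner_add_left] at hV
  nlinarith [mul_le_mul_of_nonneg_right hfar (norm_nonneg (x - y))]
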